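/- arXiv:1805.09174 — 7 statements merged into one kernel-verified Lean document; each statement's English description precedes it below -/
import Mathlib

section
/- There is a universal constant C > 0 with the following property. Fix integers d, K, T ≥ 1 and a real G ≥ 1 with (4G/3)·T² ≥ e^e, points θ₁,…,θ_K ∈ B₁, an initial probability vector π̂₀ = (π̂_{1,0},…,π̂_{K,0}) with all entries positive, and loss functions ℓ₁,…,ℓ_T satisfying (A1) and (A2, deterministic form) with constants α > 0 and β ∈ (0,1]. Run the Squint/BOA algorithm with parameter E = 4G/3 and produce the predictions θ̂₀,…,θ̂_{T−1}. Then for every probability vector π = (π₁,…,π_K): (1/T) Σ_{t=1}^T Σ_{k=1}^K π_k (ℓ_t(θ̂_{t−1}) − ℓ_t(θ_k)) ≤ C ((KL(π, π̂₀) + log log(GT) + 1)/(α T))^{1/(2−β)} + C (KL(π, π̂₀) + log log(GT) + 1) G / T, where KL(π, π̂₀) := Σ_{k : π_k > 0} π_k log(π_k / π̂_{k,0}) is the Kullback–Leibler divergence. -/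
open Finset

/-- ℓ¹-norm on `Fin d → ℝ`. -/
noncomputable def l1 {d : ℕ} (x : Fin d → ℝ) : ℝ := ∑ i, |x i|

/-- Euclidean dot product. -/
noncomputable def dotp {d : ℕ} (x y : Fin d → ℝ) : ℝ := ∑ i, x i * y i

/-- Gradient of `f` at `θ` (coordinates of the Fréchet derivative). -/
noncomputable def grad {d : ℕ} (f : (Fin d → ℝ) → ℝ) (θ : Fin d → ℝ) : Fin d → ℝ :=
  fun i => fderiv ℝ f θ (Pi.single i 1)

/-- The Squint/BOA weight update: given parameter `E`, number of learning rates `M`,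
initial weights `π0` and linearized regrets `r`, the weight of expert `k` after
observing rounds `1,…,t`.  The learning rates are `η i = (e^i E)⁻¹`, `i = 1,…,M`. -/
noncomputable def boaWeight {K : ℕ} (E : ℝ) (M : ℕ) (π0 : Fin K → ℝ)
    (r : ℕ → Fin K → ℝ) (t : ℕ) (k : Fin K) : ℝ :=
  (∑ i ∈ Finset.Icc 1 M, (Real.exp i * E)⁻¹ *
      Real.exp ((Real.exp i * E)⁻¹ * ∑ s ∈ Finset.Icc 1 t,
        (r s k - (Real.exp i * E)⁻¹ * (r s k) ^ 2)) * π0 k) /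
  (∑ i ∈ Finset.Icc 1 M, ∑ j, π0 j * (Real.exp i * E)⁻¹ *
      Real.exp ((Real.exp i * E)⁻¹ * ∑ s ∈ Finset.Icc 1 t,
        (r s j - (Real.exp i * E)⁻¹ * (r s j) ^ 2)))

/-- Kullback–Leibler divergence between two probability vectors. -/
noncomputable def klDiv' {K : ℕ} (π π0 : Fin K → ℝ) : ℝ :=
  ∑ k, if 0 < π k then π k * Real.log (π k / π0 k) else 0

theorem exp_sub_sq_le_one_add {x : ℝ} (hx : -(3 / 5) ≤ x) : Real.exp (x - x ^ 2) ≤ 1 + x := by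
  rcases le_total 0 x with h | h
  · have h1 : 1 - x + x ^ 2 ≤ Real.exp (-(x - x ^ 2)) := by
      linarith [Real.add_one_le_exp (-(x - x ^ 2))]
    have h2 : 0 < 1 - x + x ^ 2 := by nlinarith [sq_nonneg (x - 1)]
    have h3 : Real.exp (x - x ^ 2) * Real.exp (-(x - x ^ 2)) = 1 := by
      rw [← Real.exp_add]; simp
    have h4 : Real.exp (x - x ^ 2) * (1 - x + x ^ 2) ≤ (1 + x) * (1 - x + x ^ 2) := by
      have := mul_le_mul_of_nonneg_left h1 (Real.exp_pos (x - x ^ 2)).le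
      nlinarith [pow_nonneg h 3]
    exact le_of_mul_le_mul_right h4 h2
  · obtain ⟨u, rfl⟩ : ∃ u, x = -u := ⟨-x, by ring⟩
    have hu : 0 ≤ u := by linarith
    have hu' : u ≤ 3 / 5 := by linarith
    have h1 : 1 + (u + u ^ 2) + (u + u ^ 2) ^ 2 / 2 + (u + u ^ 2) ^ 3 / 6
        ≤ Real.exp (u + u ^ 2) := by
      have := Real.sum_le_exp_of_nonneg (show 0 ≤ u + u ^ 2 by positivity) 4
      simp [Finset.sum_range_succ, Nat.factorial] at this
      linarith
    have h2 : 1 ≤ (1 + (u + u ^ 2) + (u + u ^ 2) ^ 2 / 2 + (u + u ^ 2) ^ 3 / 6) * (1 - u) := by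
      have h3 : 0 ≤ 1 - u - u ^ 2 - u ^ 3 + u * (1 + u) ^ 3 * (1 - u) / 3 := by
        have h5 : u * (1 + 3 * u) * (2 / 5) ≤ u * (1 + u) ^ 3 * (1 - u) := by
          have : (1 + 3 * u) * (2 / 5) ≤ (1 + u) ^ 3 * (1 - u) := by
            apply mul_le_mul _ (by linarith) (by norm_num) (by positivity)
            nlinarith [pow_nonneg hu 3, pow_nonneg hu 2]
          nlinarith
        nlinarith [mul_nonneg hu hu, mul_nonneg (mul_nonneg hu hu) (sub_nonneg.2 hu'),
          mul_nonneg hu (sub_nonneg.2 hu')]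
      nlinarith [mul_nonneg (sq_nonneg u) h3]
    have h3 : 1 ≤ Real.exp (u + u ^ 2) * (1 - u) :=
      h2.trans (mul_le_mul_of_nonneg_right h1 (by linarith))
    have h4 : Real.exp (-u - (-u) ^ 2) = (Real.exp (u + u ^ 2))⁻¹ := by
      rw [← Real.exp_neg]; congr 1; ring
    rw [h4, inv_le_iff_one_le_mul₀ (Real.exp_pos _)]
    linarith

/-- The Donsker–Varadhan inequality on a finite set. -/
theorem sum_mul_le_klDiv'_add_log {K : ℕ} {π π0 X : Fin K → ℝ} {m : ℝ} (hm : 0 < m)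
    (hπ : ∀ k, 0 ≤ π k) (hπ1 : ∑ k, π k = 1) (hπ0 : ∀ k, 0 < π0 k)
    (h : ∑ k, π0 k * Real.exp (X k) ≤ m) :
    ∑ k, π k * X k ≤ klDiv' π π0 + Real.log m := by
  have key : ∀ k, π k * X k - (if 0 < π k then π k * Real.log (π k / π0 k) else 0)
      - π k * Real.log m ≤ π0 k * Real.exp (X k) / m - π k := by
    intro k
    have h0 := hπ0 k
    split_ifs with hk
    · have h1 := Real.add_one_le_exp (X k - Real.log (π k / π0 k) - Real.log m)
      rw [Real.exp_sub, Real.exp_sub, Real.exp_log (by positivity), Real.exp_log hm] at h1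
      have h2 := mul_le_mul_of_nonneg_left h1 hk.le
      have h3 : π k * (Real.exp (X k) / (π k / π0 k) / m) = π0 k * Real.exp (X k) / m := by
        field_simp
      rw [h3] at h2
      linarith
    · have : π k = 0 := le_antisymm (not_lt.1 hk) (hπ k)
      simp only [this, zero_mul, sub_zero]
      positivity
  have hs := Finset.sum_le_sum fun k (_ : k ∈ Finset.univ) => key k
  simp only [Finset.sum_sub_distrib, ← Finset.sum_mul, ← Finset.sum_div, hπ1] at hs
  have : (∑ k, π0 k * Real.exp (X k)) / m ≤ 1 := (div_le_one hm).2 h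
  unfold klDiv'
  linarith

theorem klDiv'_nonneg {K : ℕ} {π π0 : Fin K → ℝ} (hπ : ∀ k, 0 ≤ π k) (hπ1 : ∑ k, π k = 1)
    (hπ0 : ∀ k, 0 < π0 k) (hπ01 : ∑ k, π0 k = 1) : 0 ≤ klDiv' π π0 := by
  have := sum_mul_le_klDiv'_add_log (X := 0) one_pos hπ hπ1 hπ0 (by simp [hπ01])
  simpa using this

theorem rpow_one_sub_mul_le {x y β : ℝ} (hx : 0 ≤ x) (hy : 0 < y) (hβ : 0 < β) (hβ1 : β ≤ 1) :
    y ^ (1 - β) * x ≤ x ^ (1 / β) + y := by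
  set z := x ^ (1 / β) with hz
  have hz0 : 0 ≤ z := Real.rpow_nonneg hx _
  have hxz : x = z ^ β := by
    rw [hz, ← Real.rpow_mul hx, one_div, inv_mul_cancel₀ hβ.ne', Real.rpow_one]
  have hs : 0 < z + y := by positivity
  calc y ^ (1 - β) * x = y ^ (1 - β) * z ^ β := by rw [hxz]
    _ ≤ (z + y) ^ (1 - β) * (z + y) ^ β := by
        gcongr <;> linarith
    _ = z + y := by
        rw [← Real.rpow_add hs]; simp

theorem l1_sum_smul_le_one {K d : ℕ} {p : Fin K → ℝ} {v : Fin K → Fin d → ℝ}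
    (hp : ∀ k, 0 ≤ p k) (hp1 : ∑ k, p k = 1) (hv : ∀ k, l1 (v k) ≤ 1) :
    l1 (∑ k, p k • v k) ≤ 1 := by
  calc l1 (∑ k, p k • v k) ≤ ∑ i, ∑ k, p k * |v k i| := by
        refine Finset.sum_le_sum fun i _ => ?_
        rw [Finset.sum_apply]
        refine (Finset.abs_sum_le_sum_abs _ _).trans (le_of_eq ?_)
        exact Finset.sum_congr rfl fun k _ => by
          rw [Pi.smul_apply, smul_eq_mul, abs_mul, abs_of_nonneg (hp k)]
    _ = ∑ k, p k * l1 (v k) := by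
        rw [Finset.sum_comm]; simp [l1, Finset.mul_sum]
    _ ≤ ∑ k, p k * 1 := Finset.sum_le_sum fun k _ => mul_le_mul_of_nonneg_left (hv k) (hp k)
    _ = 1 := by simp [hp1]

theorem abs_dotp_sub_le {d : ℕ} {g x y : Fin d → ℝ} {G : ℝ} (hG : 0 ≤ G)
    (hg : ∀ i, |g i| ≤ G) (hx : l1 x ≤ 1) (hy : l1 y ≤ 1) : |dotp g (x - y)| ≤ 2 * G := by
  calc |dotp g (x - y)| ≤ ∑ i, G * (|x i| + |y i|) := by
        refine (Finset.abs_sum_le_sum_abs _ _).trans (Finset.sum_le_sum fun i _ => ?_)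
        rw [abs_mul]
        exact mul_le_mul (hg i) (abs_sub _ _) (abs_nonneg _) hG
    _ = G * (l1 x + l1 y) := by
        rw [← Finset.mul_sum, Finset.sum_add_distrib]; rfl
    _ ≤ 2 * G := by nlinarith

theorem sum_mul_dotp_sub_eq_zero {K d : ℕ} {p : Fin K → ℝ} {v : Fin K → Fin d → ℝ}
    (g : Fin d → ℝ) (hp1 : ∑ k, p k = 1) :
    ∑ k, p k * dotp g (∑ j, p j • v j - v k) = 0 := by
  set w := ∑ j, p j • v j with hw
  have h : ∀ k, p k * dotp g (w - v k) = ∑ i, (g i * w i * p k - g i * (p k * v k i)) := by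
    intro k
    rw [dotp, Finset.mul_sum]
    exact Finset.sum_congr rfl fun i _ => by simp only [Pi.sub_apply]; ring
  rw [Finset.sum_congr rfl fun k _ => h k, Finset.sum_comm]
  refine Finset.sum_eq_zero fun i _ => ?_
  rw [Finset.sum_sub_distrib, ← Finset.mul_sum, ← Finset.mul_sum, hp1, hw, Finset.sum_apply]
  simp

/-- The exponential weight of expert `k` at learning rate `(e^i E)⁻¹` after `t` rounds. -/
noncomputable def expertWeight {K : ℕ} (E : ℝ) (π0 : Fin K → ℝ) (r : ℕ → Fin K → ℝ)
    (t i : ℕ) (k : Fin K) : ℝ :=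
  π0 k * Real.exp ((Real.exp i * E)⁻¹ * ∑ s ∈ Finset.Icc 1 t,
    (r s k - (Real.exp i * E)⁻¹ * (r s k) ^ 2))

section Squint

variable {K : ℕ} {E : ℝ} {M : ℕ} {π0 : Fin K → ℝ} {r : ℕ → Fin K → ℝ}

theorem expertWeight_pos (hπ0 : ∀ k, 0 < π0 k) (t i : ℕ) (k : Fin K) :
    0 < expertWeight E π0 r t i k := mul_pos (hπ0 k) (Real.exp_pos _)

theorem boaWeight_eq (t : ℕ) (k : Fin K) :
    boaWeight E M π0 r t k =
      (∑ i ∈ Finset.Icc 1 M, (Real.exp i * E)⁻¹ * expertWeight E π0 r t i k) /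
      ∑ j, ∑ i ∈ Finset.Icc 1 M, (Real.exp i * E)⁻¹ * expertWeight E π0 r t i j := by
  rw [boaWeight, Finset.sum_comm (s := Finset.univ)]
  congr 1
  · exact Finset.sum_congr rfl fun i _ => by rw [expertWeight]; ring
  · refine Finset.sum_congr rfl fun i _ => Finset.sum_congr rfl fun j _ => ?_
    rw [expertWeight]; ring

theorem sum_rate_mul_expertWeight_pos (hE : 0 < E) (hM : 1 ≤ M) (hπ0 : ∀ k, 0 < π0 k)
    (t : ℕ) (k : Fin K) :
    0 < ∑ i ∈ Finset.Icc 1 M, (Real.exp i * E)⁻¹ * expertWeight E π0 r t i k :=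
  Finset.sum_pos
    (fun i _ => mul_pos (inv_pos.2 (mul_pos (Real.exp_pos _) hE)) (expertWeight_pos hπ0 t i k))
    ⟨1, by simp [hM]⟩

theorem sum_sum_rate_mul_expertWeight_pos (hK : 1 ≤ K) (hE : 0 < E) (hM : 1 ≤ M)
    (hπ0 : ∀ k, 0 < π0 k) (t : ℕ) :
    0 < ∑ j, ∑ i ∈ Finset.Icc 1 M, (Real.exp i * E)⁻¹ * expertWeight E π0 r t i j :=
  Finset.sum_pos (fun j _ => sum_rate_mul_expertWeight_pos hE hM hπ0 t j) ⟨⟨0, hK⟩, by simp⟩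

theorem boaWeight_nonneg (hK : 1 ≤ K) (hE : 0 < E) (hM : 1 ≤ M) (hπ0 : ∀ k, 0 < π0 k)
    (t : ℕ) (k : Fin K) : 0 ≤ boaWeight E M π0 r t k := by
  rw [boaWeight_eq]
  exact div_nonneg (sum_rate_mul_expertWeight_pos hE hM hπ0 t k).le
    (sum_sum_rate_mul_expertWeight_pos hK hE hM hπ0 t).le

theorem sum_boaWeight (hK : 1 ≤ K) (hE : 0 < E) (hM : 1 ≤ M) (hπ0 : ∀ k, 0 < π0 k)
    (t : ℕ) : ∑ k, boaWeight E M π0 r t k = 1 := by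
  simp only [boaWeight_eq, ← Finset.sum_div]
  exact div_self (sum_sum_rate_mul_expertWeight_pos hK hE hM hπ0 t).ne'

theorem boaWeight_zero (hE : 0 < E) (hM : 1 ≤ M) (hπ01 : ∑ k, π0 k = 1) (k : Fin K) :
    boaWeight E M π0 r 0 k = π0 k := by
  have hS : 0 < ∑ i ∈ Finset.Icc 1 M, (Real.exp i * E)⁻¹ :=
    Finset.sum_pos (fun i _ => inv_pos.2 (mul_pos (Real.exp_pos _) hE)) ⟨1, by simp [hM]⟩
  rw [boaWeight_eq]
  simp only [expertWeight, Finset.Icc_eq_empty_of_lt zero_lt_one, Finset.sum_empty, mul_zero,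
    Real.exp_zero, mul_one, ← Finset.sum_mul, ← Finset.mul_sum, hπ01]
  exact mul_div_cancel_left₀ _ hS.ne'

theorem expertWeight_succ_le (hE : 0 < E) (hπ0 : ∀ k, 0 < π0 k) {t i : ℕ} (hi : 1 ≤ i)
    {k : Fin K} (hr : |r (t + 1) k| ≤ 3 / 2 * E) :
    expertWeight E π0 r (t + 1) i k ≤
      expertWeight E π0 r t i k +
        (Real.exp i * E)⁻¹ * expertWeight E π0 r t i k * r (t + 1) k := by
  have hei : (5 / 2 : ℝ) ≤ Real.exp i := by
    have : Real.exp 1 ≤ Real.exp i := Real.exp_le_exp.2 (by exact_mod_cast hi)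
    linarith [Real.exp_one_gt_d9]
  have hη : 0 < (Real.exp i * E)⁻¹ := by positivity
  have hx : |(Real.exp i * E)⁻¹ * r (t + 1) k| ≤ 3 / 5 := by
    rw [abs_mul, abs_of_pos hη, inv_mul_le_iff₀ (by positivity)]
    nlinarith
  have h := exp_sub_sq_le_one_add (neg_le_of_abs_le hx)
  have hw := expertWeight_pos (E := E) (r := r) hπ0 t i k
  have heq : expertWeight E π0 r (t + 1) i k = expertWeight E π0 r t i k *
      Real.exp ((Real.exp i * E)⁻¹ * r (t + 1) k - ((Real.exp i * E)⁻¹ * r (t + 1) k) ^ 2) := by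
    rw [expertWeight, expertWeight, mul_assoc, ← Real.exp_add,
      Finset.sum_Icc_succ_top (by omega)]
    congr 2
    ring
  rw [heq]
  nlinarith [mul_le_mul_of_nonneg_left h hw.le]

theorem sum_sum_expertWeight_le (hK : 1 ≤ K) (hE : 0 < E) (hM : 1 ≤ M) (hπ0 : ∀ k, 0 < π0 k)
    (hπ01 : ∑ k, π0 k = 1) (T : ℕ) (hr : ∀ t, t < T → ∀ k, |r (t + 1) k| ≤ 3 / 2 * E)
    (hmix : ∀ t, t < T → ∑ k, boaWeight E M π0 r t k * r (t + 1) k = 0) :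
    ∑ i ∈ Finset.Icc 1 M, ∑ k, expertWeight E π0 r T i k ≤ M := by
  induction T with
  | zero => simp [expertWeight, hπ01]
  | succ t ih =>
    refine le_trans ?_ (ih (fun s hs => hr s (by omega)) (fun s hs => hmix s (by omega)))
    have h0 := hmix t (by omega)
    simp only [boaWeight_eq, div_mul_eq_mul_div, ← Finset.sum_div] at h0
    rw [div_eq_zero_iff,
      or_iff_left (sum_sum_rate_mul_expertWeight_pos hK hE hM hπ0 t).ne'] at h0
    simp only [Finset.sum_mul] at h0
    rw [Finset.sum_comm] at h0
    calc _ ≤ ∑ i ∈ Finset.Icc 1 M, ∑ k, (expertWeight E π0 r t i k +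
          (Real.exp i * E)⁻¹ * expertWeight E π0 r t i k * r (t + 1) k) :=
          Finset.sum_le_sum fun i hi => Finset.sum_le_sum fun k _ =>
            expertWeight_succ_le hE hπ0 (Finset.mem_Icc.1 hi).1 (hr t (by omega) k)
      _ = _ := by simp only [Finset.sum_add_distrib, h0, add_zero]

/-- Second-order regret bound, simultaneously for all learning rates on the grid. -/
theorem linearized_regret_le (hK : 1 ≤ K) (hE : 0 < E) (hM : 1 ≤ M) (hπ0 : ∀ k, 0 < π0 k)
    (hπ01 : ∑ k, π0 k = 1) (T : ℕ) (hr : ∀ t, t < T → ∀ k, |r (t + 1) k| ≤ 3 / 2 * E)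
    (hmix : ∀ t, t < T → ∑ k, boaWeight E M π0 r t k * r (t + 1) k = 0)
    {π : Fin K → ℝ} (hπ : ∀ k, 0 ≤ π k) (hπ1 : ∑ k, π k = 1) {i : ℕ} (hi : 1 ≤ i) (hiM : i ≤ M) :
    ∑ t ∈ Finset.Icc 1 T, ∑ k, π k * r t k ≤
      (klDiv' π π0 + Real.log M) * (Real.exp i * E)
        + (Real.exp i * E)⁻¹ * ∑ t ∈ Finset.Icc 1 T, ∑ k, π k * (r t k) ^ 2 := by
  have hη : 0 < Real.exp i * E := by positivity
  have h1 : ∑ k, expertWeight E π0 r T i k ≤ M :=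
    (Finset.single_le_sum (f := fun i => ∑ k, expertWeight E π0 r T i k)
      (fun j _ => Finset.sum_nonneg fun k _ => (expertWeight_pos hπ0 T j k).le)
      (Finset.mem_Icc.2 ⟨hi, hiM⟩)).trans
      (sum_sum_expertWeight_le hK hE hM hπ0 hπ01 T hr hmix)
  have h2 := sum_mul_le_klDiv'_add_log (by positivity) hπ hπ1 hπ0 h1
  have h3 : ∑ k, π k * ((Real.exp i * E)⁻¹ * ∑ s ∈ Finset.Icc 1 T,
      (r s k - (Real.exp i * E)⁻¹ * (r s k) ^ 2)) =
      (Real.exp i * E)⁻¹ * (∑ t ∈ Finset.Icc 1 T, ∑ k, π k * r t k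
        - (Real.exp i * E)⁻¹ * ∑ t ∈ Finset.Icc 1 T, ∑ k, π k * (r t k) ^ 2) := by
    rw [Finset.sum_comm, Finset.sum_comm (f := fun t k => π k * (r t k) ^ 2)]
    simp only [Finset.mul_sum, ← Finset.sum_sub_distrib]
    exact Finset.sum_congr rfl fun k _ => Finset.sum_congr rfl fun t _ => by ring
  rw [h3, inv_mul_le_iff₀ hη] at h2
  linarith

end Squint

/-- Choosing the rate on the geometric grid: `a` is an ideal learning rate for the regret `R`
with second-order term `V`. -/
theorem regret_le_of_grid {E A a R V b : ℝ} {M : ℕ} (hM : 1 ≤ M) (hE : 0 < E) (hA : 0 ≤ A)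
    (ha : 0 < a) (hV : 0 ≤ V) (hVM : (Real.exp M * E)⁻¹ * V ≤ b) (hb : 0 ≤ b)
    (hR : ∀ i : ℕ, 1 ≤ i → i ≤ M → R ≤ A * (Real.exp i * E) + (Real.exp i * E)⁻¹ * V) :
    R ≤ a * V + 3 * A / a + 3 * A * E + b := by
  have he := Real.exp_one_lt_d9
  have hAa : 0 ≤ A / a := by positivity
  have hAE : 0 ≤ A * E := by positivity
  have haV : 0 ≤ a * V := by positivity
  have h3 : 3 * A / a = 3 * (A / a) := by ring
  rw [h3]
  have hlow : ∀ i : ℕ, a < (Real.exp i * E)⁻¹ → A * (Real.exp i * E) ≤ A / a := by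
    intro i hi
    have hpos : 0 < Real.exp i * E := by positivity
    rw [div_eq_mul_inv]
    exact mul_le_mul_of_nonneg_left ((lt_inv_comm₀ ha hpos).1 hi).le hA
  by_cases hex : ∃ i : ℕ, 1 ≤ i ∧ i ≤ M ∧ (Real.exp i * E)⁻¹ ≤ a
  · classical
    obtain ⟨hi1, hiM, hia⟩ := Nat.find_spec hex
    set i := Nat.find hex
    have hRi := hR i hi1 hiM
    have hVi : (Real.exp i * E)⁻¹ * V ≤ a * V := mul_le_mul_of_nonneg_right hia hV
    rcases Nat.eq_or_lt_of_le hi1 with h1 | h1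
    · rw [← h1] at hRi hVi
      simp only [Nat.cast_one] at hRi hVi
      nlinarith
    · have hmin := Nat.find_min hex (m := i - 1) (by omega)
      have hprev := hlow (i - 1) (not_le.1 fun hc => hmin ⟨by omega, by omega, hc⟩)
      have hexp : Real.exp (i : ℝ) = Real.exp 1 * Real.exp (i - 1 : ℕ) := by
        rw [← Real.exp_add]; congr 1; push_cast [hi1]; ring
      have : A * (Real.exp i * E) = Real.exp 1 * (A * (Real.exp (i - 1 : ℕ) * E)) := by
        rw [hexp]; ring
      nlinarith [Real.exp_pos 1]
  · have hM' := hlow M (not_le.1 fun hc => hex ⟨M, hM, le_rfl, hc⟩)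
    linarith [hR M hM le_rfl]

theorem log_mul_sq_le {G T : ℝ} (hG : 1 ≤ G) (hT : 1 ≤ T) :
    Real.log ((4 * G / 3) * T ^ 2) ≤ 1 / 3 + 2 * Real.log (G * T) := by
  have hGT : 0 < G * T := by positivity
  have h2 : Real.log (4 * G / 3 * T ^ 2) ≤ Real.log (4 / 3 * (G * T) ^ 2) := by
    refine Real.log_le_log (by positivity) ?_
    nlinarith [mul_nonneg (mul_nonneg (sub_nonneg.2 hG) (sq_nonneg T)) (zero_le_one.trans hG)]
  rw [Real.log_mul (x := 4 / 3) (by norm_num) (by positivity), Real.log_pow] at h2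
  have h3 := Real.log_le_sub_one_of_pos (show (0 : ℝ) < 4 / 3 by norm_num)
  push_cast at h2
  linarith

theorem one_le_log_of_exp_exp_le {G T : ℝ} (hG : 1 ≤ G) (hT : 1 ≤ T)
    (h : Real.exp (Real.exp 1) ≤ (4 * G / 3) * T ^ 2) : 1 ≤ Real.log (G * T) := by
  have h1 := (Real.le_log_iff_exp_le (by positivity)).2 h
  have h2 := log_mul_sq_le hG hT
  linarith [Real.exp_one_gt_d9]

theorem log_ceil_log_le {G T : ℝ} (hG : 1 ≤ G) (hT : 1 ≤ T)
    (h : Real.exp (Real.exp 1) ≤ (4 * G / 3) * T ^ 2) :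
    Real.log ⌈Real.log ((4 * G / 3) * T ^ 2)⌉₊ ≤ 2 * (Real.log (Real.log (G * T)) + 1) := by
  have hL := one_le_log_of_exp_exp_le hG hT h
  have h1 := (Real.le_log_iff_exp_le (by positivity)).2 h
  have h2 := log_mul_sq_le hG hT
  have h0 : 0 < Real.log (4 * G / 3 * T ^ 2) := by linarith [Real.exp_one_gt_d9]
  have h4 := Nat.ceil_lt_add_one h0.le
  have h5 : (0 : ℝ) < ⌈Real.log (4 * G / 3 * T ^ 2)⌉₊ := by exact_mod_cast Nat.ceil_pos.2 h0
  have h6 : Real.log ⌈Real.log ((4 * G / 3) * T ^ 2)⌉₊ ≤ Real.log (2 ^ 2 * Real.log (G * T)) :=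
    Real.log_le_log h5 (by linarith)
  rw [Real.log_mul (x := 2 ^ 2) (by norm_num) (by positivity), Real.log_pow] at h6
  have h7 := Real.log_nonneg hL
  push_cast at h6
  linarith [Real.log_two_lt_d9]

/-- At the ideal learning rate `α y ^ (1 - β)`, the price `B / (α T y ^ (1 - β))` is `y`. -/
theorem div_mul_rpow_one_sub_eq {A α T β : ℝ} (hA : 0 < A) (hα : 0 < α) (hT : 0 < T)
    (hβ1 : β ≤ 1) :
    A / (α * ((A / (α * T)) ^ (1 / (2 - β))) ^ (1 - β)) =
      T * (A / (α * T)) ^ (1 / (2 - β)) := by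
  have hB : 0 < A / (α * T) := by positivity
  set y := (A / (α * T)) ^ (1 / (2 - β)) with hy
  have hy0 : 0 < y := Real.rpow_pos_of_pos hB _
  have h : y ^ (1 - β) * y = A / (α * T) := by
    nth_rewrite 2 [← Real.rpow_one y]
    rw [← Real.rpow_add hy0, hy, ← Real.rpow_mul hB.le]
    have h2 : (2 - β) ≠ 0 := by linarith
    have : 1 / (2 - β) * (1 - β + 1) = 1 := by field_simp; ring
    rw [this, Real.rpow_one]
  have h1 : 0 < y ^ (1 - β) := Real.rpow_pos_of_pos hy0 _
  rw [eq_div_iff (by positivity)] at h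
  rw [div_eq_iff (by positivity)]
  linarith

/-- Theorem 1 of the paper (deterministic form): fast-rate quantile bound
for the Squint/BOA algorithm run with `E = 4G/3`. -/
theorem fast_rate_quantile_bound_BOA :
    ∃ C : ℝ, 0 < C ∧
      ∀ (d K T : ℕ), 1 ≤ d → 1 ≤ K → 1 ≤ T →
      ∀ (G : ℝ), 1 ≤ G → Real.exp (Real.exp 1) ≤ (4 * G / 3) * (T : ℝ) ^ 2 →
      ∀ (θs : Fin K → Fin d → ℝ), (∀ k, l1 (θs k) ≤ 1) →
      ∀ (π0 : Fin K → ℝ), (∀ k, 0 < π0 k) → (∑ k, π0 k) = 1 →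
      ∀ (ℓ : ℕ → (Fin d → ℝ) → ℝ) (α β : ℝ), 0 < α → 0 < β → β ≤ 1 →
      -- (A1): convex differentiable losses with gradients bounded by `G` in sup-norm on B₁
      (∀ t, 1 ≤ t → t ≤ T → ConvexOn ℝ Set.univ (ℓ t)) →
      (∀ t, 1 ≤ t → t ≤ T → Differentiable ℝ (ℓ t)) →
      (∀ t, 1 ≤ t → t ≤ T → ∀ θ : Fin d → ℝ, l1 θ ≤ 1 → ∀ i, |grad (ℓ t) θ i| ≤ G) →
      -- (A2, deterministic form): weak exp-concavity
      (∀ t, 1 ≤ t → t ≤ T → ∀ θ θ' : Fin d → ℝ, l1 θ ≤ 1 → l1 θ' ≤ 1 →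
        ℓ t θ - ℓ t θ' ≤ dotp (grad (ℓ t) θ) (θ - θ')
          - (α * (dotp (grad (ℓ t) θ) (θ - θ')) ^ 2) ^ ((1 : ℝ) / β)) →
      -- the algorithm: predictions θ̂ and weights π̂
      ∀ (θh : ℕ → Fin d → ℝ) (πh : ℕ → Fin K → ℝ) (r : ℕ → Fin K → ℝ),
      (∀ t k, r t k = dotp (grad (ℓ t) (θh (t - 1))) (θh (t - 1) - θs k)) →
      (∀ k, πh 0 k = π0 k) →
      (∀ t, 1 ≤ t → t ≤ T → ∀ k,
        πh t k = boaWeight (4 * G / 3) ⌈Real.log ((4 * G / 3) * (T : ℝ) ^ 2)⌉₊ π0 r t k) →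
      (∀ t, t ≤ T → θh t = ∑ k, πh t k • θs k) →
      -- conclusion: for every probability vector π
      ∀ (π : Fin K → ℝ), (∀ k, 0 ≤ π k) → (∑ k, π k) = 1 →
        (1 / (T : ℝ)) * ∑ t ∈ Finset.Icc 1 T, ∑ k, π k * (ℓ t (θh (t - 1)) - ℓ t (θs k))
          ≤ C * (((klDiv' π π0 + Real.log (Real.log (G * T)) + 1) / (α * T))
              ^ ((1 : ℝ) / (2 - β)))
            + C * (klDiv' π π0 + Real.log (Real.log (G * T)) + 1) * G / T := by
  refine ⟨11, by norm_num, ?_⟩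
  intro d K T _ hK hT G hG hGT θs hθs π0 hπ0 hπ01 ℓ α β hα hβ hβ1 _ _ hgrad hexpc θh πh r
    hr hπh0 hπh hθh π hπ hπ1
  have hT1 : (1 : ℝ) ≤ T := by exact_mod_cast hT
  have hlog := one_le_log_of_exp_exp_le hG hT1 hGT
  have hlogM := log_ceil_log_le hG hT1 hGT
  have hKL := klDiv'_nonneg hπ hπ1 hπ0 hπ01
  have hexpM : (4 * G / 3) * (T : ℝ) ^ 2 ≤
      Real.exp ⌈Real.log ((4 * G / 3) * (T : ℝ) ^ 2)⌉₊ :=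
    (Real.log_le_iff_le_exp (by positivity)).1 (Nat.le_ceil _)
  have hM : 1 ≤ ⌈Real.log ((4 * G / 3) * (T : ℝ) ^ 2)⌉₊ := by
    refine Nat.ceil_pos.2 ((Real.exp_pos 1).trans_le ?_)
    exact (Real.le_log_iff_exp_le (by positivity)).2 hGT
  generalize ⌈Real.log ((4 * G / 3) * (T : ℝ) ^ 2)⌉₊ = M at *
  have hE : 0 < 4 * G / 3 := by positivity
  have hweight : ∀ t, t ≤ T → ∀ k, πh t k = boaWeight (4 * G / 3) M π0 r t k := by
    intro t ht k
    rcases Nat.eq_zero_or_pos t with rfl | h0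
    · rw [hπh0, boaWeight_zero hE hM hπ01]
    · exact hπh t h0 ht k
  have hnn : ∀ t, t ≤ T → ∀ k, 0 ≤ πh t k := fun t ht k => by
    rw [hweight t ht]; exact boaWeight_nonneg hK hE hM hπ0 t k
  have hsum : ∀ t, t ≤ T → ∑ k, πh t k = 1 := fun t ht => by
    simp only [hweight t ht]; exact sum_boaWeight hK hE hM hπ0 t
  have hball : ∀ t, t ≤ T → l1 (θh t) ≤ 1 := fun t ht => by
    rw [hθh t ht]; exact l1_sum_smul_le_one (hnn t ht) (hsum t ht) hθs
  have hrbound : ∀ t, t < T → ∀ k, |r (t + 1) k| ≤ 2 * G := fun t ht k => by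
    rw [hr]
    exact abs_dotp_sub_le (by linarith)
      (hgrad (t + 1) (by omega) ht _ (hball _ (by simpa using ht.le)))
      (hball _ (by simpa using ht.le)) (hθs k)
  have hmix : ∀ t, t < T → ∑ k, boaWeight (4 * G / 3) M π0 r t k * r (t + 1) k = 0 := by
    intro t ht
    simp only [← hweight t ht.le]
    have := sum_mul_dotp_sub_eq_zero (v := θs) (grad (ℓ (t + 1)) (θh t)) (hsum t ht.le)
    rw [← hθh t ht.le] at this
    simpa only [hr, Nat.add_sub_cancel] using this
  set A := klDiv' π π0 + Real.log (Real.log (G * T)) + 1 with hA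
  have hA1 : 1 ≤ A := by linarith [Real.log_nonneg hlog]
  set R := ∑ t ∈ Finset.Icc 1 T, ∑ k, π k * r t k with hRdef
  set V := ∑ t ∈ Finset.Icc 1 T, ∑ k, π k * (r t k) ^ 2 with hVdef
  have hV : 0 ≤ V :=
    Finset.sum_nonneg fun t _ => Finset.sum_nonneg fun k _ => mul_nonneg (hπ k) (sq_nonneg _)
  have hVle : V ≤ T * (4 * G ^ 2) := by
    have h1 : ∀ t ∈ Finset.Icc 1 T, ∑ k, π k * (r t k) ^ 2 ≤ 4 * G ^ 2 := by
      intro t ht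
      obtain ⟨ht1, htT⟩ := Finset.mem_Icc.1 ht
      obtain ⟨s, rfl⟩ : ∃ s, t = s + 1 := ⟨t - 1, by omega⟩
      calc ∑ k, π k * (r (s + 1) k) ^ 2 ≤ ∑ k, π k * (4 * G ^ 2) := by
            refine Finset.sum_le_sum fun k _ => mul_le_mul_of_nonneg_left ?_ (hπ k)
            have := sq_le_sq' (neg_le_of_abs_le (hrbound s htT k))
              (le_of_abs_le (hrbound s htT k))
            linarith
        _ = 4 * G ^ 2 := by rw [← Finset.sum_mul, hπ1, one_mul]
    simpa using Finset.sum_le_sum h1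
  have hVM : (Real.exp M * (4 * G / 3))⁻¹ * V ≤ 9 / 4 := by
    rw [inv_mul_le_iff₀ (by positivity)]
    have h1 : T * (4 * G ^ 2) ≤ T ^ 2 * (4 * G ^ 2) := by
      gcongr; nlinarith
    have h2 := mul_le_mul_of_nonneg_right hexpM hE.le
    nlinarith
  have hreg : ∀ i : ℕ, 1 ≤ i → i ≤ M → R ≤ (2 * A) * (Real.exp i * (4 * G / 3))
      + (Real.exp i * (4 * G / 3))⁻¹ * V := by
    intro i hi hiM
    refine (linearized_regret_le hK hE hM hπ0 hπ01 T
      (fun t ht k => (hrbound t ht k).trans (by linarith)) hmix hπ hπ1 hi hiM).trans ?_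
    gcongr
    linarith
  set y := (A / (α * T)) ^ ((1 : ℝ) / (2 - β)) with hy
  have hy0 : 0 < y := Real.rpow_pos_of_pos (by positivity) _
  have ha : 0 < α * y ^ (1 - β) := mul_pos hα (Real.rpow_pos_of_pos hy0 _)
  have hR := regret_le_of_grid hM hE (by linarith : 0 ≤ 2 * A) ha hV hVM (by norm_num) hreg
  have hprice : 3 * (2 * A) / (α * y ^ (1 - β)) = 6 * (T * y) := by
    rw [hy, ← div_mul_rpow_one_sub_eq (by linarith) hα (by linarith) hβ1]; ring
  have hloss : ∑ t ∈ Finset.Icc 1 T, ∑ k, π k * (ℓ t (θh (t - 1)) - ℓ t (θs k)) ≤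
      R - α * y ^ (1 - β) * V + T * y := by
    calc _ ≤ ∑ t ∈ Finset.Icc 1 T, ∑ k, (π k * r t k
          - α * y ^ (1 - β) * (π k * (r t k) ^ 2) + π k * y) := by
          refine Finset.sum_le_sum fun t ht => Finset.sum_le_sum fun k _ => ?_
          obtain ⟨ht1, htT⟩ := Finset.mem_Icc.1 ht
          have h1 := hexpc t ht1 htT _ _ (hball (t - 1) (by omega)) (hθs k)
          rw [← hr] at h1
          have h2 := rpow_one_sub_mul_le (x := α * (r t k) ^ 2) (by positivity) hy0 hβ hβ1
          have h3 := mul_le_mul_of_nonneg_left (h1.trans (sub_le_sub_left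
            (sub_le_iff_le_add.2 h2) _)) (hπ k)
          linarith
      _ = _ := by
          simp only [Finset.sum_add_distrib, Finset.sum_sub_distrib, ← Finset.mul_sum,
            ← Finset.sum_mul, hπ1]
          simp [hRdef, hVdef]
  rw [hprice] at hR
  have hAG : 1 ≤ A * G := one_le_mul_of_one_le_of_one_le hA1 hG
  rw [one_div, inv_mul_le_iff₀ (by linarith)]
  have hfin : (T : ℝ) * (11 * y + 11 * A * G / T) = 11 * (T * y) + 11 * (A * G) := by
    field_simp
  rw [hfin]
  nlinarith [mul_pos (zero_lt_one.trans_le hT1) hy0]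
end

section
/- Let θ, θ' ∈ B₁ with ‖θ − θ'‖₁ + 1 − ‖θ‖₁ > 0. Then D(θ, θ') ≤ ‖θ − θ'‖₁ / (‖θ − θ'‖₁ + 1 − ‖θ‖₁). -/
open Finset

/-- Averaging accelerability `D(θ, θ')`. -/
noncomputable def Dacc {d : ℕ} (θ θ' : Fin d → ℝ) : ℝ :=
  sInf {p : ℝ | p ∈ Set.Icc (0 : ℝ) 1 ∧ l1 (θ - (1 - p) • θ') ≤ p}

/-- Convexity of the ℓ¹-norm, applied to `θ - (1 - p) • θ' = p • θ + (1 - p) • (θ - θ')`. -/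
theorem l1_sub_smul_le {d : ℕ} (θ θ' : Fin d → ℝ) {p : ℝ} (hp0 : 0 ≤ p) (hp1 : p ≤ 1) :
    l1 (θ - (1 - p) • θ') ≤ p * l1 θ + (1 - p) * l1 (θ - θ') := by
  unfold l1
  rw [Finset.mul_sum, Finset.mul_sum, ← Finset.sum_add_distrib]
  refine Finset.sum_le_sum fun i _ => ?_
  simp only [Pi.sub_apply, Pi.smul_apply, smul_eq_mul]
  calc |θ i - (1 - p) * θ' i| = |p * θ i + (1 - p) * (θ i - θ' i)| := by ring_nf
    _ ≤ |p * θ i| + |(1 - p) * (θ i - θ' i)| := abs_add_le _ _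
    _ = p * |θ i| + (1 - p) * |θ i - θ' i| := by
      rw [abs_mul, abs_mul, abs_of_nonneg hp0, abs_of_nonneg (sub_nonneg.2 hp1)]

/-- Lemma 1 of the paper: the averaging accelerability is controlled by the ℓ¹-distance. -/
theorem Dacc_le_l1 {d : ℕ} (θ θ' : Fin d → ℝ)
    (hθ : l1 θ ≤ 1) (hθ' : l1 θ' ≤ 1)
    (hpos : 0 < l1 (θ - θ') + 1 - l1 θ) :
    Dacc θ θ' ≤ l1 (θ - θ') / (l1 (θ - θ') + 1 - l1 θ) := by
  have hδ : 0 ≤ l1 (θ - θ') := Finset.sum_nonneg fun i _ => abs_nonneg _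
  set p : ℝ := l1 (θ - θ') / (l1 (θ - θ') + 1 - l1 θ)
  have hp0 : 0 ≤ p := div_nonneg hδ hpos.le
  have hp1 : p ≤ 1 := (div_le_one hpos).2 (by linarith)
  have hpeq : p * (l1 (θ - θ') + 1 - l1 θ) = l1 (θ - θ') := div_mul_cancel₀ _ hpos.ne'
  refine csInf_le ⟨0, fun q hq => hq.1.1⟩ ⟨⟨hp0, hp1⟩, ?_⟩
  calc l1 (θ - (1 - p) • θ') ≤ p * l1 θ + (1 - p) * l1 (θ - θ') :=
        l1_sub_smul_le θ θ' hp0 hp1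
    _ = p := by linarith
end

section
/- Let θ, θ' ∈ B₁ with θ' ≠ 0. Assume ‖θ'‖₁ ≥ ‖θ‖₁ and that for every coordinate 1 ≤ i ≤ d, sign(θ'_i) ∈ {0, sign(θ_i)}. Then D(θ, θ') ≤ 1 − min_{i : θ'_i ≠ 0} (|θ_i| / |θ'_i|) ≤ ‖θ − θ'‖_∞ / Δ, where Δ := min_{i : θ'_i ≠ 0} |θ_i| (which is strictly positive under the sign assumption). -/
open Finset

/-- sup (ℓ∞) norm on `Fin d → ℝ`. -/
noncomputable def linf {d : ℕ} (x : Fin d → ℝ) : ℝ := ⨆ i, |x i|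

theorem isLeast_sInf_of_finite_index {ι : Type*} [Finite ι] {P : ι → Prop} (f : ι → ℝ)
    (h : ∃ i, P i) :
    IsLeast {x : ℝ | ∃ i, P i ∧ x = f i} (sInf {x : ℝ | ∃ i, P i ∧ x = f i}) := by
  have hfin : {x : ℝ | ∃ i, P i ∧ x = f i}.Finite :=
    (Set.finite_range f).subset fun x ⟨i, _, hx⟩ => ⟨i, hx.symm⟩
  obtain ⟨i, hi⟩ := h
  have hne : {x : ℝ | ∃ i, P i ∧ x = f i}.Nonempty := ⟨f i, i, hi, rfl⟩
  exact ⟨hne.csInf_mem hfin, fun x hx => csInf_le hfin.bddBelow hx⟩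

theorem abs_apply_le_linf {d : ℕ} (x : Fin d → ℝ) (i : Fin d) : |x i| ≤ linf x :=
  le_ciSup (f := fun i => |x i|) (Set.finite_range _).bddAbove i

theorem Dacc_le_of_mem {d : ℕ} {θ θ' : Fin d → ℝ} {p : ℝ} (h0 : 0 ≤ p) (h1 : p ≤ 1)
    (h : l1 (θ - (1 - p) • θ') ≤ p) : Dacc θ θ' ≤ p :=
  csInf_le ⟨0, fun _ hx => hx.1.1⟩ ⟨⟨h0, h1⟩, h⟩

theorem ne_zero_of_sign_eq {a b : ℝ} (h : Real.sign b = 0 ∨ Real.sign b = Real.sign a)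
    (hb : b ≠ 0) : a ≠ 0 := by
  rintro rfl
  simp [Real.sign_eq_zero_iff, hb] at h

theorem abs_sub_mul_of_sign_eq {a b c : ℝ} (h : Real.sign b = 0 ∨ Real.sign b = Real.sign a)
    (hc : c * |b| ≤ |a|) : |a - c * b| = |a| - c * |b| := by
  rcases lt_trichotomy b 0 with hb | rfl | hb
  · have ha : a < 0 := by
      rcases lt_trichotomy a 0 with ha | rfl | ha
      · exact ha
      · norm_num [Real.sign_of_neg hb] at h
      · norm_num [Real.sign_of_neg hb, Real.sign_of_pos ha] at h
    rw [abs_of_neg hb, abs_of_neg ha] at *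
    rw [abs_of_nonpos (by linarith)]
    ring
  · simp
  · have ha : 0 < a := by
      rcases lt_trichotomy a 0 with ha | rfl | ha
      · norm_num [Real.sign_of_pos hb, Real.sign_of_neg ha] at h
      · norm_num [Real.sign_of_pos hb] at h
      · exact ha
    rw [abs_of_pos hb, abs_of_pos ha] at *
    rw [abs_of_nonneg (by linarith)]

/-- Lemma 2 of the paper: when `θ'` has signs compatible with `θ` and at least the
same ℓ¹-norm, the averaging accelerability is controlled in sup-norm. -/
theorem Dacc_le_of_sign_compatible {d : ℕ} (θ θ' : Fin d → ℝ)
    (hθ : l1 θ ≤ 1) (hθ' : l1 θ' ≤ 1) (hne : θ' ≠ 0)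
    (hnorm : l1 θ ≤ l1 θ')
    (hsign : ∀ i, Real.sign (θ' i) = 0 ∨ Real.sign (θ' i) = Real.sign (θ i)) :
    0 < sInf {x : ℝ | ∃ i, θ' i ≠ 0 ∧ x = |θ i|} ∧
    Dacc θ θ' ≤ 1 - sInf {x : ℝ | ∃ i, θ' i ≠ 0 ∧ x = |θ i| / |θ' i|} ∧
    1 - sInf {x : ℝ | ∃ i, θ' i ≠ 0 ∧ x = |θ i| / |θ' i|}
      ≤ linf (θ - θ') / sInf {x : ℝ | ∃ i, θ' i ≠ 0 ∧ x = |θ i|} := by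
  obtain ⟨j, hj⟩ : ∃ i, θ' i ≠ 0 := Function.ne_iff.mp hne
  have hΔ := isLeast_sInf_of_finite_index (P := fun i => θ' i ≠ 0) (fun i => |θ i|) ⟨j, hj⟩
  have hr := isLeast_sInf_of_finite_index (P := fun i => θ' i ≠ 0)
    (fun i => |θ i| / |θ' i|) ⟨j, hj⟩
  set Δ := sInf {x : ℝ | ∃ i, θ' i ≠ 0 ∧ x = |θ i|}
  set r := sInf {x : ℝ | ∃ i, θ' i ≠ 0 ∧ x = |θ i| / |θ' i|}
  have hΔ0 : 0 < Δ := by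
    obtain ⟨i, hi, hx⟩ := hΔ.1
    rw [hx]
    exact abs_pos.mpr (ne_zero_of_sign_eq (hsign i) hi)
  obtain ⟨k, hk, hrk⟩ := hr.1
  have hr0 : 0 ≤ r := by rw [hrk]; positivity
  have hle : ∀ i, r * |θ' i| ≤ |θ i| := by
    intro i
    by_cases hi : θ' i = 0
    · simp [hi]
    · exact (le_div_iff₀ (abs_pos.mpr hi)).mp (hr.2 ⟨i, hi, rfl⟩)
  have hpos : 0 < l1 θ' :=
    (abs_pos.mpr hj).trans_le
      (Finset.single_le_sum (f := fun i => |θ' i|) (fun i _ => abs_nonneg _) (Finset.mem_univ j))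
  have hsum : r * l1 θ' ≤ l1 θ := by
    unfold l1
    rw [Finset.mul_sum]
    exact Finset.sum_le_sum fun i _ => hle i
  have hr1 : r ≤ 1 := by
    by_contra! h
    nlinarith
  refine ⟨hΔ0, Dacc_le_of_mem (by linarith) (by linarith) ?_, ?_⟩
  · have hl1 : l1 (θ - (1 - (1 - r)) • θ') = l1 θ - r * l1 θ' := by
      unfold l1
      rw [Finset.mul_sum, ← Finset.sum_sub_distrib]
      refine Finset.sum_congr rfl fun i _ => ?_
      simpa using abs_sub_mul_of_sign_eq (hsign i) (hle i)
    rw [hl1]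
    nlinarith
  · have hk0 : 0 < |θ' k| := abs_pos.mpr hk
    have hΔk : Δ ≤ |θ k| := hΔ.2 ⟨k, hk, rfl⟩
    have hrk' : r * |θ' k| = |θ k| := by rw [hrk, div_mul_cancel₀ _ hk0.ne']
    have hdiff : |θ' k| - |θ k| ≤ linf (θ - θ') :=
      (abs_sub_abs_le_abs_sub _ _).trans
        ((abs_sub_comm _ _).trans_le (abs_apply_le_linf (θ - θ') k))
    rw [le_div_iff₀ hΔ0]
    calc (1 - r) * Δ ≤ (1 - r) * |θ' k| :=
          mul_le_mul_of_nonneg_left (by nlinarith) (by linarith)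
      _ = |θ' k| - |θ k| := by rw [← hrk']; ring
      _ ≤ linf (θ - θ') := hdiff
end

section
/- Let θ, θ' ∈ B₁ with θ ≠ θ'. Then the set L := {λ ∈ ℝ : λ ≥ 1 and ‖λ(θ − θ') + θ'‖₁ ≤ 1} is nonempty, closed and bounded, its maximum λ* := max L is attained, and D(θ, θ') = 1/λ*. -/
open Finset

theorem l1_smul {d : ℕ} (c : ℝ) (x : Fin d → ℝ) : l1 (c • x) = |c| * l1 x := by
  simp [l1, abs_mul, Finset.mul_sum]

theorem l1_le_l1_add_add_l1 {d : ℕ} (x y : Fin d → ℝ) : l1 x ≤ l1 (x + y) + l1 y := by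
  unfold l1
  rw [← Finset.sum_add_distrib]
  refine Finset.sum_le_sum fun i _ => ?_
  simpa using abs_sub (x i + y i) (y i)

theorem l1_pos {d : ℕ} {x : Fin d → ℝ} (hx : x ≠ 0) : 0 < l1 x := by
  obtain ⟨i, hi⟩ := Function.ne_iff.mp hx
  exact Finset.sum_pos' (fun j _ => abs_nonneg (x j)) ⟨i, Finset.mem_univ i, abs_pos.mpr hi⟩

theorem continuous_l1 {d : ℕ} : Continuous (l1 : (Fin d → ℝ) → ℝ) := by
  unfold l1
  fun_prop

/-- A positive weight `p` is feasible for averaging iff the dilation by `p⁻¹` stays in the ball. -/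
theorem l1_sub_smul_le_iff {d : ℕ} (x y : Fin d → ℝ) {p : ℝ} (hp : 0 < p) :
    l1 (x - (1 - p) • y) ≤ p ↔ l1 (p⁻¹ • (x - y) + y) ≤ 1 := by
  have h : x - (1 - p) • y = p • (p⁻¹ • (x - y) + y) := by
    rw [smul_add, smul_inv_smul₀ hp.ne', sub_smul, one_smul]
    abel
  rw [h, l1_smul, abs_of_pos hp, mul_le_iff_le_one_right hp]

/-- Geometric characterization of the averaging accelerability (Appendix B of the paper):
`D(θ,θ')` is the inverse of the largest dilation `λ ≥ 1` keeping `λ(θ-θ') + θ'` in `B₁`. -/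
theorem Dacc_eq_inv_max_dilation {d : ℕ} (θ θ' : Fin d → ℝ)
    (hθ : l1 θ ≤ 1) (hθ' : l1 θ' ≤ 1) (hne : θ ≠ θ') :
    {l : ℝ | 1 ≤ l ∧ l1 (l • (θ - θ') + θ') ≤ 1}.Nonempty ∧
    IsClosed {l : ℝ | 1 ≤ l ∧ l1 (l • (θ - θ') + θ') ≤ 1} ∧
    BddAbove {l : ℝ | 1 ≤ l ∧ l1 (l • (θ - θ') + θ') ≤ 1} ∧
    sSup {l : ℝ | 1 ≤ l ∧ l1 (l • (θ - θ') + θ') ≤ 1}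
      ∈ {l : ℝ | 1 ≤ l ∧ l1 (l • (θ - θ') + θ') ≤ 1} ∧
    Dacc θ θ' = (sSup {l : ℝ | 1 ≤ l ∧ l1 (l • (θ - θ') + θ') ≤ 1})⁻¹ := by
  set S := {l : ℝ | 1 ≤ l ∧ l1 (l • (θ - θ') + θ') ≤ 1}
  have hpos : 0 < l1 (θ - θ') := l1_pos (sub_ne_zero.mpr hne)
  have hnonempty : S.Nonempty := ⟨1, le_rfl, by simpa using hθ⟩
  have hclosed : IsClosed S :=
    (isClosed_le continuous_const continuous_id).inter
      (isClosed_le (continuous_l1.comp (by fun_prop)) continuous_const)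
  have hbdd : BddAbove S := by
    refine ⟨2 / l1 (θ - θ'), fun l hl => ?_⟩
    have h := l1_le_l1_add_add_l1 (l • (θ - θ')) θ'
    rw [l1_smul, abs_of_nonneg (zero_le_one.trans hl.1)] at h
    rw [le_div_iff₀ hpos]
    linarith [hl.2]
  have hmem : sSup S ∈ S := hclosed.csSup_mem hnonempty hbdd
  refine ⟨hnonempty, hclosed, hbdd, hmem, ?_⟩
  have hsup : 0 < sSup S := zero_lt_one.trans_le hmem.1
  refine IsLeast.csInf_eq ⟨⟨⟨(inv_pos.mpr hsup).le, inv_le_one_of_one_le₀ hmem.1⟩, ?_⟩, ?_⟩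
  · rw [l1_sub_smul_le_iff θ θ' (inv_pos.mpr hsup), inv_inv]
    exact hmem.2
  · rintro p ⟨⟨hp0, hp1⟩, hp⟩
    rcases hp0.eq_or_lt with rfl | hp0
    · simp only [sub_zero, one_smul] at hp
      exact absurd hp hpos.not_ge
    · have hpS : p⁻¹ ∈ S := ⟨(one_le_inv₀ hp0).mpr hp1, (l1_sub_smul_le_iff θ θ' hp0).mp hp⟩
      exact inv_le_of_inv_le₀ hp0 (le_csSup hbdd hpS)
end

section
/- Let ε ≥ 0, let d₀ be a positive integer, and let θ, θ' ∈ ℝ^d with ‖θ − θ'‖_∞ ≤ ε and ‖θ‖₀ ≤ d₀. Then ‖S_ε(θ')‖₁ ≥ ‖θ‖₁ − 2 d₀ ε. -/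
open Finset

/-- ℓ⁰ "norm": number of nonzero coordinates. -/
noncomputable def l0 {d : ℕ} (x : Fin d → ℝ) : ℕ :=
  (Finset.univ.filter fun i => x i ≠ 0).card

/-- Soft-threshold operator. -/
noncomputable def softThresh {d : ℕ} (ε : ℝ) (x : Fin d → ℝ) : Fin d → ℝ :=
  fun i => Real.sign (x i) * max (|x i| - ε) 0

theorem abs_softThresh_apply {d : ℕ} {ε : ℝ} (hε : 0 ≤ ε) (x : Fin d → ℝ) (i : Fin d) :
    |softThresh ε x i| = max (|x i| - ε) 0 := by
  rw [softThresh, abs_mul, abs_of_nonneg (le_max_right (|x i| - ε) 0)]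
  rcases lt_trichotomy (x i) 0 with h | h | h
  · simp [Real.sign_of_neg h]
  · simp [h, hε]
  · simp [Real.sign_of_pos h]

/-- ℓ¹-norm lower bound for the soft-threshold (proof of Lemma 3 of the paper). -/
theorem softThresh_l1_lower_bound {d : ℕ} (ε : ℝ) (hε : 0 ≤ ε) (d0 : ℕ) (hd0 : 0 < d0)
    (θ θ' : Fin d → ℝ) (happrox : linf (θ - θ') ≤ ε) (hsparse : l0 θ ≤ d0) :
    l1 θ - 2 * (d0 : ℝ) * ε ≤ l1 (softThresh ε θ') := by
  have hpt (i : Fin d) :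
      |θ i| - (if θ i ≠ 0 then 2 * ε else 0) ≤ |softThresh ε θ' i| := by
    rw [abs_softThresh_apply hε]
    split_ifs with h
    · have hi : |θ i - θ' i| ≤ ε := (abs_apply_le_linf (θ - θ') i).trans happrox
      have htri := abs_sub_abs_le_abs_sub (θ i) (θ' i)
      exact le_max_of_le_left (by linarith)
    · simp [not_not.mp h]
  have hsum : ∑ i, (if θ i ≠ 0 then 2 * ε else 0) = 2 * (l0 θ : ℝ) * ε := by
    rw [← Finset.sum_filter, Finset.sum_const, nsmul_eq_mul, l0]
    ring
  have hcard : (l0 θ : ℝ) ≤ d0 := by exact_mod_cast hsparse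
  calc l1 θ - 2 * (d0 : ℝ) * ε ≤ l1 θ - 2 * (l0 θ : ℝ) * ε := by gcongr
    _ = ∑ i, (|θ i| - if θ i ≠ 0 then 2 * ε else 0) := by
      rw [Finset.sum_sub_distrib, hsum, l1]
    _ ≤ l1 (softThresh ε θ') := Finset.sum_le_sum fun i _ => hpt i
end

section
/- Let E > 0, let T ≥ 1 be an integer, let a > 0 and let V be a real with 0 ≤ V ≤ E² T. Let Λ ⊂ (0, ∞) be a finite set such that 1/(eE) ∈ Λ, 1/(E²T²) ∈ Λ, and for every x ∈ [1/(E²T²), 1/(eE)] there exists λ ∈ Λ with λ/√e ≤ x ≤ √e · λ. Then min_{λ ∈ Λ} (λ V + a/λ) ≤ 4 √(a V) + 6 a E + 2/T. -/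
open Finset

/-- The learning-rate grid optimization lemma from the proof of Theorem 1 of the paper:
optimizing `λ V + a/λ` over a geometric grid of learning rates between `1/(E²T²)` and
`1/(eE)` achieves `4√(aV) + 6aE + 2/T`. -/
theorem grid_learning_rate_optimization (E : ℝ) (hE : 0 < E) (T : ℕ) (hT : 1 ≤ T)
    (a V : ℝ) (ha : 0 < a) (hV0 : 0 ≤ V) (hVT : V ≤ E ^ 2 * T)
    (Λ : Finset ℝ) (hΛpos : ∀ l ∈ Λ, 0 < l)
    (h1 : 1 / (Real.exp 1 * E) ∈ Λ)
    (h2 : 1 / (E ^ 2 * (T : ℝ) ^ 2) ∈ Λ)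
    (hgrid : ∀ x : ℝ, 1 / (E ^ 2 * (T : ℝ) ^ 2) ≤ x → x ≤ 1 / (Real.exp 1 * E) →
      ∃ l ∈ Λ, l / Real.sqrt (Real.exp 1) ≤ x ∧ x ≤ Real.sqrt (Real.exp 1) * l) :
    ∃ l ∈ Λ, l * V + a / l ≤ 4 * Real.sqrt (a * V) + 6 * a * E + 2 / T := by
  have hT0 : (0 : ℝ) < T := by exact_mod_cast hT
  have he : Real.exp 1 < 3 := Real.exp_one_lt_three
  have hs0 : 0 ≤ √(a * V) := Real.sqrt_nonneg _
  have hs : √(a * V) * √(a * V) = a * V := Real.mul_self_sqrt (by positivity)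
  have haE : 0 < a * E := by positivity
  have hinvT : 0 < 1 / (T : ℝ) := by positivity
  have htwo : 2 / (T : ℝ) = 2 * (1 / T) := by ring
  have hendpoint : a / (1 / (Real.exp 1 * E)) ≤ 6 * a * E := by
    have : a / (1 / (Real.exp 1 * E)) = Real.exp 1 * (a * E) := by
      rw [div_div_eq_mul_div]; ring
    rw [this]
    nlinarith
  rcases hV0.eq_or_lt with rfl | hV
  · refine ⟨_, h1, ?_⟩
    linarith
  have hs_pos : 0 < √(a * V) := Real.sqrt_pos.mpr (by positivity)
  -- The unconstrained minimizer is `√(a * V) / V`, that is, `√(a / V)`.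
  obtain ⟨x, hx⟩ : ∃ x, x = √(a * V) / V := ⟨_, rfl⟩
  have hx_pos : 0 < x := hx ▸ div_pos hs_pos hV
  have hxV : x * V = √(a * V) := by rw [hx, div_mul_cancel₀ _ hV.ne']
  have hax : a = √(a * V) * x := by
    rw [hx, ← mul_div_assoc, hs, mul_div_cancel_right₀ _ hV.ne']
  rcases lt_or_ge (1 / (Real.exp 1 * E)) x with hlarge | hupper
  · refine ⟨_, h1, ?_⟩
    have := mul_le_mul_of_nonneg_right hlarge.le hV0
    linarith
  rcases lt_or_ge x (1 / (E ^ 2 * (T : ℝ) ^ 2)) with hsmall | hlower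
  · refine ⟨_, h2, ?_⟩
    have hleft : 1 / (E ^ 2 * (T : ℝ) ^ 2) * V ≤ 1 / (T : ℝ) := by
      calc 1 / (E ^ 2 * (T : ℝ) ^ 2) * V ≤ 1 / (E ^ 2 * (T : ℝ) ^ 2) * (E ^ 2 * T) := by gcongr
        _ = 1 / (T : ℝ) := by field_simp
    have hright : a / (1 / (E ^ 2 * (T : ℝ) ^ 2)) ≤ √(a * V) := by
      rw [div_le_iff₀ (by positivity)]
      nlinarith [mul_le_mul_of_nonneg_left hsmall.le hs0]
    linarith
  · obtain ⟨l, hl, hlx, hxl⟩ := hgrid x hlower hupper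
    refine ⟨l, hl, ?_⟩
    have hl0 := hΛpos l hl
    have hq : √(Real.exp 1) ≤ 2 := Real.sqrt_le_iff.mpr ⟨by norm_num, by linarith⟩
    rw [div_le_iff₀ (Real.sqrt_pos.mpr (Real.exp_pos 1))] at hlx
    have hleft : l * V ≤ 2 * √(a * V) := by
      have : l ≤ 2 * x := by nlinarith
      nlinarith [mul_le_mul_of_nonneg_right this hV0]
    have hright : a / l ≤ 2 * √(a * V) := by
      rw [div_le_iff₀ hl0]
      have : x ≤ 2 * l := by nlinarith
      nlinarith [mul_le_mul_of_nonneg_left this hs0]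
    linarith
end

section
/- Let x₁, x₂ ≥ 0 and let R be a real number with R ≤ x₂. Then R + x₁ √(x₂ − R) ≤ max{3 x₁²/4, max(R, 0) + x₁ √(x₂)}. -/
/-- The elementary one-step recursion bound used in the induction of the proof of
Theorem 3 of the paper. -/
theorem one_step_recursion_bound (x1 x2 R : ℝ)
    (hx1 : 0 ≤ x1) (hx2 : 0 ≤ x2) (hR : R ≤ x2) :
    R + x1 * Real.sqrt (x2 - R)
      ≤ max (3 * x1 ^ 2 / 4) (max R 0 + x1 * Real.sqrt x2) := by
  rcases le_total 0 R with h0 | h0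
  · apply le_max_of_le_right
    gcongr
    · exact le_max_left R 0
    · linarith
  · have hs := Real.sq_sqrt (sub_nonneg.mpr hR)
    have ht := Real.sq_sqrt hx2
    have hst : √x2 ≤ √(x2 - R) := Real.sqrt_le_sqrt (by linarith)
    have ht0 := Real.sqrt_nonneg x2
    rw [max_eq_right h0]
    rcases le_total x1 (2 * √x2) with h | h
    · apply le_max_of_le_right
      nlinarith [mul_nonneg (sub_nonneg.mpr hst)
        (show 0 ≤ √(x2 - R) + √x2 - x1 by linarith)]
    · apply le_max_of_le_left
      nlinarith [sq_nonneg (√(x2 - R) - x1 / 2)]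
end
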